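/- Let γ > 0 and let g be analytic on 𝔻 with constants 0 < m ≤ |g'(z)| ≤ M for all z ∈ 𝔻. Then for every analytic f on 𝔻: (1−|z|)^{γ}|(V_g f)(z)| → 0 as |z| → 1⁻ if and only if (1−|z|)^{γ+1}|f(z)| → 0 as |z| → 1⁻; that is, the optimal domain [V_g, A_0^{−γ}] equals A_0^{−(γ+1)}. -/

import Mathlib

open Metric

/-- The generalized Volterra operator `(V_g f)(z) = ∫₀ᶻ f(ξ)g'(ξ)dξ = z·∫₀¹ f(sz)g'(sz) ds`. -/
noncomputable def Vg (g f : ℂ → ℂ) (z : ℂ) : ℂ :=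
  z * ∫ s in (0:ℝ)..1, f ((s : ℂ) * z) * deriv g ((s : ℂ) * z)

/-- `(1-|z|)^β·|f(z)| → 0` as `|z| → 1⁻`. -/
def vanishesAtBoundary (β : ℝ) (f : ℂ → ℂ) : Prop :=
  ∀ ε > (0:ℝ), ∃ r < (1:ℝ), ∀ z ∈ ball (0:ℂ) 1,
    r < ‖z‖ → (1 - ‖z‖) ^ β * ‖f z‖ < ε

/-- Chain rule along the ray through `z`. -/
lemma HasDerivAt.comp_ofReal_mul {F : ℂ → ℂ} {F' z : ℂ} {s : ℝ}
    (hF : HasDerivAt F F' ((s:ℂ) * z)) :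
    HasDerivAt (fun t : ℝ => F ((t:ℂ) * z)) (z * F') s := by
  have hline : HasDerivAt (fun t : ℝ => (t:ℂ) * z) z s := by
    simpa using (Complex.ofRealCLM.hasDerivAt (x := s)).mul_const z
  simpa [Function.comp_def] using hF.scomp s hline

/-- On the unit disc, `V_g f` is a primitive of `f g'`. -/
lemma hasDerivAt_Vg {g f : ℂ → ℂ} (hg : DifferentiableOn ℂ g (ball (0:ℂ) 1))
    (hf : DifferentiableOn ℂ f (ball (0:ℂ) 1)) {z : ℂ} (hz : z ∈ ball (0:ℂ) 1) :
    HasDerivAt (Vg g f) (f z * deriv g z) z := by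
  have hh : DifferentiableOn ℂ (fun w => f w * deriv g w) (ball (0:ℂ) 1) :=
    hf.mul (hg.deriv isOpen_ball)
  obtain ⟨H, hH⟩ := hh.isExactOn_ball
  have key : ∀ w ∈ ball (0:ℂ) 1, Vg g f w = H w - H 0 := by
    intro w hw
    have hmem : ∀ s ∈ Set.uIcc (0:ℝ) 1, (s:ℂ) * w ∈ ball (0:ℂ) 1 := by
      intro s hs
      rw [Set.uIcc_of_le zero_le_one] at hs
      rw [mem_ball_zero_iff] at hw ⊢
      rw [norm_mul, Complex.norm_real, Real.norm_of_nonneg hs.1]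
      exact (mul_le_of_le_one_left (norm_nonneg _) hs.2).trans_lt hw
    have := intervalIntegral.integral_eq_sub_of_hasDerivAt
      (f := fun s : ℝ => H ((s:ℂ) * w))
      (f' := fun s : ℝ => w * (f ((s:ℂ) * w) * deriv g ((s:ℂ) * w))) (a := 0) (b := 1)
      (fun s hs => (hH _ (hmem s hs)).comp_ofReal_mul)
      (ContinuousOn.intervalIntegrable (continuousOn_const.mul
        (hh.continuousOn.comp (by fun_prop) hmem)))
    rw [intervalIntegral.integral_const_mul] at this
    simpa [Vg] using this
  refine ((hH z hz).sub_const (H 0)).congr_of_eventuallyEq ?_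
  filter_upwards [isOpen_ball.mem_nhds hz] with w hw using key w hw

/-- If `F` is `o((1-|z|)^{-γ})` at the boundary, then `F'` is `o((1-|z|)^{-(γ+1)})`. -/
lemma vanishesAtBoundary.of_hasDerivAt {γ : ℝ} (hγ : 0 < γ) {F h : ℂ → ℂ}
    (hF : ∀ z ∈ ball (0:ℂ) 1, HasDerivAt F (h z) z) (hv : vanishesAtBoundary γ F) :
    vanishesAtBoundary (γ + 1) h := by
  intro ε hε
  obtain ⟨r, hr, H⟩ := hv (ε / 2 ^ (γ + 1) / 2) (by positivity)
  refine ⟨(1 + 2 * r) / 3, by linarith, fun z hz hrz => ?_⟩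
  rw [mem_ball_zero_iff] at hz
  set ρ := (1 - ‖z‖) / 2 with hρ
  have hρ0 : 0 < ρ := by rw [hρ]; linarith
  have hsub : closedBall z ρ ⊆ ball (0:ℂ) 1 := fun w hw => by
    rw [mem_closedBall_iff_norm] at hw
    rw [mem_ball_zero_iff]
    linarith [norm_le_norm_add_norm_sub' w z]
  have hdiff : DiffContOnCl ℂ F (ball z ρ) := by
    refine DifferentiableOn.diffContOnCl ?_
    rw [closure_ball z hρ0.ne']
    exact fun w hw => (hF w (hsub hw)).differentiableAt.differentiableWithinAt
  have hbound : ∀ w ∈ sphere z ρ, ‖F w‖ ≤ ε / 2 ^ (γ + 1) / 2 / ρ ^ γ := by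
    intro w hw
    have hwb := hsub (sphere_subset_closedBall hw)
    rw [mem_sphere_iff_norm] at hw
    have h1 := norm_le_norm_add_norm_sub' w z
    have h2 := norm_le_norm_add_norm_sub w z
    have h3 := H w hwb (by linarith)
    rw [le_div_iff₀ (by positivity), mul_comm]
    refine le_trans (mul_le_mul_of_nonneg_right ?_ (norm_nonneg _)) h3.le
    exact Real.rpow_le_rpow hρ0.le (by linarith) hγ.le
  have hc := Complex.norm_deriv_le_of_forall_mem_sphere_norm_le hρ0 hdiff hbound
  rw [(hF z (mem_ball_zero_iff.2 hz)).deriv, div_div, ← Real.rpow_add_one hρ0.ne'] at hc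
  have hz2 : 1 - ‖z‖ = 2 * ρ := by rw [hρ]; ring
  rw [hz2, Real.mul_rpow zero_le_two hρ0.le]
  calc _ ≤ 2 ^ (γ + 1) * ρ ^ (γ + 1) * (ε / 2 ^ (γ + 1) / 2 / ρ ^ (γ + 1)) := by gcongr
    _ = ε / 2 := by field_simp
    _ < ε := by linarith

/-- If `F'` is `o((1-|z|)^{-(γ+1)})` at the boundary with `γ > 0` and `F 0 = 0`, then `F` is
`o((1-|z|)^{-γ})`. -/
lemma vanishesAtBoundary.of_deriv {γ : ℝ} (hγ : 0 < γ) {F h : ℂ → ℂ}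
    (hF : ∀ z ∈ ball (0:ℂ) 1, HasDerivAt F (h z) z) (hF0 : F 0 = 0)
    (hh : ContinuousOn h (ball (0:ℂ) 1)) (hv : vanishesAtBoundary (γ + 1) h) :
    vanishesAtBoundary γ F := by
  intro ε hε
  set δ := ε * γ / 2 with hδ
  have hδ0 : 0 < δ := by positivity
  obtain ⟨r, hr, H⟩ := hv δ hδ0
  obtain ⟨K, hK⟩ := (isCompact_closedBall (0:ℂ) r).exists_bound_of_continuousOn
    (hh.mono (closedBall_subset_ball hr))
  have hbd : ∀ w ∈ ball (0:ℂ) 1, ‖h w‖ ≤ |K| + δ * (1 - ‖w‖) ^ (-γ - 1) := by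
    intro w hw
    have hw1 : 0 < 1 - ‖w‖ := by rw [mem_ball_zero_iff] at hw; linarith
    have hpos : 0 < (1 - ‖w‖) ^ (γ + 1) := by positivity
    rcases le_or_gt ‖w‖ r with hwr | hwr
    · have := hK w (mem_closedBall_zero_iff.2 hwr)
      have : 0 ≤ δ * (1 - ‖w‖) ^ (-γ - 1) := by positivity
      linarith [le_abs_self K]
    · have h1 := H w hw hwr
      rw [show -γ - 1 = -(γ + 1) by ring, Real.rpow_neg hw1.le, ← div_eq_mul_inv]
      have : ‖h w‖ ≤ δ / (1 - ‖w‖) ^ (γ + 1) := by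
        rw [le_div_iff₀ hpos, mul_comm]; exact h1.le
      linarith [abs_nonneg K]
  have hgrow : ∀ z ∈ ball (0:ℂ) 1, ‖F z‖ ≤ |K| + δ / γ * (1 - ‖z‖) ^ (-γ) := by
    intro z hz
    have hz1 : ‖z‖ < 1 := mem_ball_zero_iff.1 hz
    have hmul : ∀ s ∈ Set.Icc (0:ℝ) 1, s * ‖z‖ < 1 := fun s hs =>
      (mul_le_of_le_one_left (norm_nonneg _) hs.2).trans_lt hz1
    have hnorm : ∀ s ∈ Set.Icc (0:ℝ) 1, ‖(s:ℂ) * z‖ = s * ‖z‖ := fun s hs => by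
      rw [norm_mul, Complex.norm_real, Real.norm_of_nonneg hs.1]
    have hmem : ∀ s ∈ Set.Icc (0:ℝ) 1, (s:ℂ) * z ∈ ball (0:ℂ) 1 := fun s hs => by
      rw [mem_ball_zero_iff, hnorm s hs]; exact hmul s hs
    have hφ : ∀ s ∈ Set.Icc (0:ℝ) 1,
        HasDerivAt (fun t : ℝ => F ((t:ℂ) * z)) (z * h ((s:ℂ) * z)) s :=
      fun s hs => (hF _ (hmem s hs)).comp_ofReal_mul
    have hB : ∀ s ∈ Set.Icc (0:ℝ) 1,
        HasDerivAt (fun t : ℝ => |K| * t + δ / γ * (1 - t * ‖z‖) ^ (-γ))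
          (|K| + δ * ‖z‖ * (1 - s * ‖z‖) ^ (-γ - 1)) s := fun s hs => by
      have h1 : HasDerivAt (fun t : ℝ => 1 - t * ‖z‖) (-‖z‖) s := by
        simpa using ((hasDerivAt_id s).mul_const ‖z‖).const_sub 1
      have h2 := h1.rpow_const (p := -γ) (Or.inl (by linarith [hmul s hs]))
      refine (((hasDerivAt_id s).const_mul |K|).add (h2.const_mul (δ / γ))).congr_deriv ?_
      field_simp
    have := image_norm_le_of_norm_deriv_right_le_deriv_boundary'
      (fun s hs => (hφ s hs).continuousAt.continuousWithinAt)
      (fun s hs => (hφ s (Set.Ico_subset_Icc_self hs)).hasDerivWithinAt)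
      (B := fun t : ℝ => |K| * t + δ / γ * (1 - t * ‖z‖) ^ (-γ))
      (by simpa [hF0] using by positivity)
      (fun s hs => (hB s hs).continuousAt.continuousWithinAt)
      (fun s hs => (hB s (Set.Ico_subset_Icc_self hs)).hasDerivWithinAt)
      (fun s hs => by
        have hs' := Set.Ico_subset_Icc_self hs
        have h1 := hbd _ (hmem s hs')
        rw [hnorm s hs'] at h1
        rw [norm_mul]
        nlinarith [norm_nonneg z, abs_nonneg K, mul_le_mul_of_nonneg_left h1 (norm_nonneg z)])
      (Set.right_mem_Icc.2 zero_le_one)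
    simpa using this
  have hlim : Filter.Tendsto (fun t : ℝ => t ^ γ * |K|) (nhds 0) (nhds 0) := by
    have := ((Real.continuous_rpow_const hγ.le).mul_const |K|).tendsto 0
    simpa [Real.zero_rpow hγ.ne'] using this
  obtain ⟨η, hη, hsmall⟩ := Metric.eventually_nhds_iff.1
    (hlim.eventually (gt_mem_nhds (half_pos hε)))
  refine ⟨1 - η, by linarith, fun z hz hzr => ?_⟩
  have hz1 : 0 < 1 - ‖z‖ := by rw [mem_ball_zero_iff] at hz; linarith
  have hs := hsmall (y := 1 - ‖z‖) (by
    rw [Real.dist_eq, sub_zero, abs_of_pos hz1]; linarith)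
  calc (1 - ‖z‖) ^ γ * ‖F z‖
      ≤ (1 - ‖z‖) ^ γ * (|K| + δ / γ * (1 - ‖z‖) ^ (-γ)) := by
        gcongr; exact hgrow z hz
    _ = (1 - ‖z‖) ^ γ * |K| + ε / 2 := by
        rw [Real.rpow_neg hz1.le, hδ]; field_simp
    _ < ε := by linarith

/-- Boundary decay passes to any function dominated by a constant multiple. -/
lemma vanishesAtBoundary.of_norm_le_mul {β C : ℝ} {u v : ℂ → ℂ} (hv : vanishesAtBoundary β v)
    (hC : 0 < C) (huv : ∀ z ∈ ball (0:ℂ) 1, ‖u z‖ ≤ C * ‖v z‖) : vanishesAtBoundary β u := by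
  intro ε hε
  obtain ⟨r, hr, H⟩ := hv (ε / C) (by positivity)
  refine ⟨r, hr, fun z hz hrz => ?_⟩
  have hz1 : 0 ≤ 1 - ‖z‖ := by rw [mem_ball_zero_iff] at hz; linarith
  have h1 := H z hz hrz
  rw [lt_div_iff₀ hC] at h1
  calc (1 - ‖z‖) ^ β * ‖u z‖ ≤ (1 - ‖z‖) ^ β * (C * ‖v z‖) := by
        gcongr; exact huv z hz
    _ = (1 - ‖z‖) ^ β * ‖v z‖ * C := by ring
    _ < ε := h1

/-- For `γ > 0` and `g` analytic on `𝔻` with `0 < m ≤ |g'| ≤ M`, an analytic `f`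
satisfies `(1-|z|)^γ|(V_g f)(z)| → 0` as `|z| → 1⁻` iff `(1-|z|)^{γ+1}|f(z)| → 0` as
`|z| → 1⁻`; i.e. `[V_g, A₀^{-γ}] = A₀^{-(γ+1)}`. -/
theorem optimalDomain_Vg_littleKorenblum
    (γ : ℝ) (hγ : 0 < γ)
    (g : ℂ → ℂ) (hg : DifferentiableOn ℂ g (ball (0:ℂ) 1))
    (m M : ℝ) (hm : 0 < m)
    (hg' : ∀ z ∈ ball (0:ℂ) 1, m ≤ ‖deriv g z‖ ∧ ‖deriv g z‖ ≤ M) :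
    ∀ f : ℂ → ℂ, DifferentiableOn ℂ f (ball (0:ℂ) 1) →
      (vanishesAtBoundary γ (Vg g f) ↔ vanishesAtBoundary (γ + 1) f) := by
  intro f hf
  have hV : ∀ z ∈ ball (0:ℂ) 1, HasDerivAt (Vg g f) (f z * deriv g z) z :=
    fun z hz => hasDerivAt_Vg hg hf hz
  have hM : 0 < M := by
    have h0 := hg' 0 (mem_ball_self one_pos)
    linarith
  constructor
  · intro hv
    refine (hv.of_hasDerivAt hγ hV).of_norm_le_mul (inv_pos.2 hm) fun z hz => ?_
    rw [norm_mul, inv_mul_eq_div, le_div_iff₀ hm]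
    exact mul_le_mul_of_nonneg_left (hg' z hz).1 (norm_nonneg _)
  · intro hv
    refine vanishesAtBoundary.of_deriv hγ hV (by simp [Vg])
      (hf.mul (hg.deriv isOpen_ball)).continuousOn (hv.of_norm_le_mul hM fun z hz => ?_)
    rw [norm_mul, mul_comm]
    exact mul_le_mul_of_nonneg_right (hg' z hz).2 (norm_nonneg _)
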